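/- Let 1 ≤ s < r ≤ ∞ and let P be a real-linear map on the real vector space H_n of n×n complex Hermitian matrices that is positive, i.e. P(X) is positive semidefinite whenever X is positive semidefinite. Let P* denote the adjoint of P with respect to the trace inner product (tr(P(X)Y) = tr(X P*(Y)) for all Hermitian X, Y), and let I be the n×n identity matrix. Then ‖P‖_{r→s} ≤ 2√2 · ‖P(I)‖_∞^{1−1/s} · ‖P*(I)‖_{(r/s)′}^{1/s}, where (r/s)′ denotes the conjugate exponent of r/s (with the conventions 1/∞ = 0 and r/s = ∞ when r = ∞). -/

import Mathlib

open scoped ENNReal ComplexOrder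

/-- The spectral `p`-norm of a Hermitian matrix: the `p`-norm of its eigenvalue vector.
(Junk value `0` for non-Hermitian matrices.) -/
noncomputable def specPNorm {n : ℕ} (p : ℝ≥0∞) (A : Matrix (Fin n) (Fin n) ℂ) : ℝ :=
  if hA : A.IsHermitian then
    (if p = ∞ then ⨆ i, |hA.eigenvalues i|
     else (∑ i, |hA.eigenvalues i| ^ p.toReal) ^ (1 / p.toReal))
  else 0

/-- The operator norm of a real-linear map on Hermitian matrices (represented as a real-linear
map on all matrices), from the spectral `r`-norm to the spectral `s`-norm: the supremum of
`‖T A‖_s / ‖A‖_r` over nonzero Hermitian `A`. -/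
noncomputable def hermOpNorm {n : ℕ} (r s : ℝ≥0∞)
    (T : Matrix (Fin n) (Fin n) ℂ →ₗ[ℝ] Matrix (Fin n) (Fin n) ℂ) : ℝ :=
  ⨆ A : {A : Matrix (Fin n) (Fin n) ℂ // A.IsHermitian ∧ A ≠ 0},
    specPNorm s (T A.1) / specPNorm r A.1

open scoped Matrix

namespace Matrix.IsHermitian

variable {n : ℕ} {A : Matrix (Fin n) (Fin n) ℂ}

/-- The rank-one orthogonal projection onto the span of the `i`-th eigenvector. -/
noncomputable def eigenProj (hA : A.IsHermitian) (i : Fin n) : Matrix (Fin n) (Fin n) ℂ :=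
  (hA.eigenvectorUnitary : Matrix (Fin n) (Fin n) ℂ) * single i i 1 *
    star (hA.eigenvectorUnitary : Matrix (Fin n) (Fin n) ℂ)

lemma posSemidef_eigenProj (hA : A.IsHermitian) (i : Fin n) : (hA.eigenProj i).PosSemidef := by
  have h : (single i i (1 : ℂ)).PosSemidef := by
    rw [← diagonal_single]
    refine PosSemidef.diagonal fun j => ?_
    by_cases hj : j = i
    · subst hj; simp
    · simp [hj]
  exact h.mul_mul_conjTranspose_same _

lemma sum_eigenProj (hA : A.IsHermitian) : ∑ i, hA.eigenProj i = 1 := by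
  have h : ∑ i : Fin n, single i i (1 : ℂ) = 1 := by
    simp_rw [← diagonal_single]
    ext j k
    by_cases hjk : j = k
    · subst hjk; simp [Matrix.sum_apply, Pi.single_apply]
    · simp [Matrix.sum_apply, hjk]
  simp only [eigenProj]
  rw [← Finset.sum_mul, ← Finset.mul_sum, h, mul_one]
  exact Unitary.coe_mul_star_self _

lemma sum_eigenvalues_smul_eigenProj (hA : A.IsHermitian) :
    ∑ i, hA.eigenvalues i • hA.eigenProj i = A := by
  have h : ∑ i : Fin n, hA.eigenvalues i • single i i (1 : ℂ) =
      diagonal (RCLike.ofReal ∘ hA.eigenvalues) := by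
    simp_rw [← diagonal_single]
    ext j k
    by_cases hjk : j = k
    · subst hjk; simp [Matrix.sum_apply, Pi.single_apply]
    · simp [Matrix.sum_apply, hjk]
  conv_rhs => rw [hA.spectral_theorem, Unitary.conjStarAlgAut_apply, ← h, Finset.mul_sum,
    Finset.sum_mul]
  refine Finset.sum_congr rfl fun i _ => ?_
  rw [mul_smul_comm, smul_mul_assoc, eigenProj]

lemma trace_mul_eigenProj (hA : A.IsHermitian) (M : Matrix (Fin n) (Fin n) ℂ) (i : Fin n) :
    (M * hA.eigenProj i).trace =
      (star (hA.eigenvectorUnitary : Matrix (Fin n) (Fin n) ℂ) * M *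
        (hA.eigenvectorUnitary : Matrix (Fin n) (Fin n) ℂ)) i i := by
  rw [eigenProj, ← mul_assoc, trace_mul_comm, ← mul_assoc, ← mul_assoc, trace_mul_single]
  simp

lemma re_trace_mul_eigenProj_nonneg (hA : A.IsHermitian) {M : Matrix (Fin n) (Fin n) ℂ}
    (hM : M.PosSemidef) (i : Fin n) : 0 ≤ (M * hA.eigenProj i).trace.re := by
  rw [trace_mul_eigenProj]
  exact (Complex.le_def.1 (hM.conjTranspose_mul_mul_same _).diag_nonneg).1

lemma trace_eigenProj (hA : A.IsHermitian) (i : Fin n) : (hA.eigenProj i).trace = 1 := by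
  rw [← one_mul (hA.eigenProj i), trace_mul_eigenProj, mul_one, Unitary.coe_star_mul_self]
  simp

lemma trace_self_mul_eigenProj (hA : A.IsHermitian) (i : Fin n) :
    (A * hA.eigenProj i).trace = hA.eigenvalues i := by
  rw [trace_mul_eigenProj]
  have h := hA.conjStarAlgAut_star_eigenvectorUnitary
  rw [Unitary.conjStarAlgAut_star_apply] at h
  rw [h]
  simp

end Matrix.IsHermitian

/-- A matrix with real trace pairing against all Hermitian matrices is Hermitian. -/
lemma Matrix.isHermitian_of_forall_trace_mul_im_eq_zero {n : ℕ} {Z : Matrix (Fin n) (Fin n) ℂ}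
    (h : ∀ X : Matrix (Fin n) (Fin n) ℂ, X.IsHermitian → (X * Z).trace.im = 0) :
    Z.IsHermitian := by
  set K := Complex.I • (Z - Zᴴ) with hK_def
  have hK : K.IsHermitian := by
    rw [Matrix.IsHermitian, hK_def, conjTranspose_smul, conjTranspose_sub,
      conjTranspose_conjTranspose]
    simp only [RCLike.star_def, Complex.conj_I]
    module
  have h1 : (K * Zᴴ).trace = (K * Z).trace := by
    have h2 : (K * Zᴴ).trace = star (K * Z).trace := by
      rw [← trace_conjTranspose, conjTranspose_mul, hK.eq, trace_mul_comm]
    rw [h2]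
    exact Complex.conj_eq_iff_im.2 (h K hK)
  have h3 : (Kᴴ * K).trace = 0 := by
    rw [hK.eq]
    nth_rewrite 2 [hK_def]
    rw [mul_smul_comm, mul_sub, trace_smul, trace_sub, h1, sub_self, smul_zero]
  have h4 : K = 0 := trace_conjTranspose_mul_self_eq_zero_iff.1 h3
  rw [hK_def, smul_eq_zero] at h4
  have h5 := h4.resolve_left Complex.I_ne_zero
  exact (sub_eq_zero.1 h5).symm

lemma Matrix.IsHermitian.map_of_posSemidef {n : ℕ} {X : Matrix (Fin n) (Fin n) ℂ}
    {P : Matrix (Fin n) (Fin n) ℂ →ₗ[ℝ] Matrix (Fin n) (Fin n) ℂ}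
    (hP : ∀ X : Matrix (Fin n) (Fin n) ℂ, X.PosSemidef → (P X).PosSemidef)
    (hX : X.IsHermitian) : (P X).IsHermitian := by
  rw [← hX.sum_eigenvalues_smul_eigenProj, map_sum, Matrix.IsHermitian,
    Matrix.conjTranspose_sum]
  refine Finset.sum_congr rfl fun i _ => ?_
  rw [map_smul, Matrix.conjTranspose_smul, (hP _ (hX.posSemidef_eigenProj i)).isHermitian.eq,
    star_trivial]

lemma Real.abs_sum_mul_rpow_le {ι : Type*} (t : Finset ι) {p : ℝ} (hp : 1 ≤ p) (w f : ι → ℝ)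
    (hw : ∀ i, 0 ≤ w i) :
    |∑ i ∈ t, w i * f i| ^ p ≤ (∑ i ∈ t, w i) ^ (p - 1) * ∑ i ∈ t, w i * |f i| ^ p := by
  have hp0 : 0 < p := by linarith
  have hW : 0 ≤ ∑ i ∈ t, w i := Finset.sum_nonneg fun i _ => hw i
  have hF : 0 ≤ ∑ i ∈ t, w i * |f i| ^ p :=
    Finset.sum_nonneg fun i _ => mul_nonneg (hw i) (by positivity)
  have h1 : |∑ i ∈ t, w i * f i| ≤ ∑ i ∈ t, w i * |f i| :=
    (Finset.abs_sum_le_sum_abs _ _).trans_eq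
      (Finset.sum_congr rfl fun i _ => by rw [abs_mul, abs_of_nonneg (hw i)])
  have h2 := h1.trans
    (Real.inner_le_weight_mul_Lp_of_nonneg t hp w (fun i => |f i|) hw fun i => abs_nonneg _)
  calc _ ≤ _ := Real.rpow_le_rpow (abs_nonneg _) h2 hp0.le
    _ = _ := by
      rw [Real.mul_rpow (by positivity) (by positivity), ← Real.rpow_mul hW,
        ← Real.rpow_mul hF, inv_mul_cancel₀ hp0.ne', Real.rpow_one]
      congr 2
      field_simp

lemma specPNorm_nonneg {n : ℕ} (p : ℝ≥0∞) (A : Matrix (Fin n) (Fin n) ℂ) :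
    0 ≤ specPNorm p A := by
  unfold specPNorm
  split_ifs
  · exact Real.iSup_nonneg fun i => abs_nonneg _
  · positivity
  · exact le_rfl

lemma abs_eigenvalues_le_specPNorm_top {n : ℕ} {A : Matrix (Fin n) (Fin n) ℂ}
    (hA : A.IsHermitian) (i : Fin n) : |hA.eigenvalues i| ≤ specPNorm ∞ A := by
  rw [specPNorm, dif_pos hA, if_pos rfl]
  exact le_ciSup (f := fun i => |hA.eigenvalues i|) (Set.finite_range _).bddAbove i

lemma specPNorm_eq_sum_rpow {n : ℕ} {p : ℝ≥0∞} (hp : p ≠ ∞) {A : Matrix (Fin n) (Fin n) ℂ}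
    (hA : A.IsHermitian) :
    specPNorm p A = (∑ i, |hA.eigenvalues i| ^ p.toReal) ^ (1 / p.toReal) := by
  rw [specPNorm, dif_pos hA, if_neg hp]

namespace Matrix.IsHermitian

variable {n : ℕ} {A B C : Matrix (Fin n) (Fin n) ℂ}

lemma re_trace_mul_eigenProj_le (hB : B.IsHermitian) (hC : C.IsHermitian) (j : Fin n) :
    (B * hC.eigenProj j).trace.re ≤ specPNorm ∞ B := by
  have h1 : (B * hC.eigenProj j).trace.re =
      ∑ k, hB.eigenvalues k * (hB.eigenProj k * hC.eigenProj j).trace.re := by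
    conv_lhs => rw [← hB.sum_eigenvalues_smul_eigenProj]
    simp [Finset.sum_mul, trace_sum]
  have h2 : ∑ k, (hB.eigenProj k * hC.eigenProj j).trace.re = 1 := by
    rw [← Complex.re_sum, ← trace_sum, ← Finset.sum_mul, sum_eigenProj, one_mul, trace_eigenProj,
      Complex.one_re]
  rw [h1]
  calc _ ≤ ∑ k, specPNorm ∞ B * (hB.eigenProj k * hC.eigenProj j).trace.re := by
        refine Finset.sum_le_sum fun k _ => mul_le_mul_of_nonneg_right ?_ ?_
        · exact (le_abs_self _).trans (abs_eigenvalues_le_specPNorm_top hB k)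
        · exact hC.re_trace_mul_eigenProj_nonneg (hB.posSemidef_eigenProj k) j
    _ = _ := by rw [← Finset.mul_sum, h2, mul_one]

/-- The diagonal of `B` in an orthonormal eigenbasis of `A` has `q`-norm at most that of the
spectrum of `B`. -/
lemma sum_abs_re_trace_eigenProj_mul_rpow_le (hA : A.IsHermitian) (hB : B.IsHermitian) {q : ℝ}
    (hq : 1 ≤ q) :
    ∑ i, |(hA.eigenProj i * B).trace.re| ^ q ≤ ∑ k, |hB.eigenvalues k| ^ q := by
  have h1 : ∀ i, |(hA.eigenProj i * B).trace.re| ^ q ≤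
      ∑ k, (hB.eigenProj k * hA.eigenProj i).trace.re * |hB.eigenvalues k| ^ q := by
    intro i
    have h2 : (hA.eigenProj i * B).trace.re =
        ∑ k, (hB.eigenProj k * hA.eigenProj i).trace.re * hB.eigenvalues k := by
      rw [trace_mul_comm]
      conv_lhs => rw [← hB.sum_eigenvalues_smul_eigenProj]
      simp [Finset.sum_mul, trace_sum, mul_comm]
    have h3 : ∑ k, (hB.eigenProj k * hA.eigenProj i).trace.re = 1 := by
      rw [← Complex.re_sum, ← trace_sum, ← Finset.sum_mul, sum_eigenProj, one_mul,
        trace_eigenProj, Complex.one_re]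
    have h4 := Real.abs_sum_mul_rpow_le Finset.univ hq
      (fun k => (hB.eigenProj k * hA.eigenProj i).trace.re) hB.eigenvalues
      fun k => hA.re_trace_mul_eigenProj_nonneg (hB.posSemidef_eigenProj k) i
    rwa [← h2, h3, Real.one_rpow, one_mul] at h4
  refine (Finset.sum_le_sum fun i _ => h1 i).trans_eq ?_
  rw [Finset.sum_comm]
  refine Finset.sum_congr rfl fun k _ => ?_
  rw [← Finset.sum_mul, ← Complex.re_sum, ← trace_sum, ← Finset.mul_sum, sum_eigenProj, mul_one,
    trace_eigenProj, Complex.one_re, one_mul]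

/-- Jensen's trace inequality for a positive map and a power function. -/
lemma sum_abs_eigenvalues_map_rpow_le (hA : A.IsHermitian)
    {P : Matrix (Fin n) (Fin n) ℂ →ₗ[ℝ] Matrix (Fin n) (Fin n) ℂ}
    (hP : ∀ X : Matrix (Fin n) (Fin n) ℂ, X.PosSemidef → (P X).PosSemidef)
    (hPA : (P A).IsHermitian) {p : ℝ} (hp : 1 ≤ p) :
    ∑ j, |hPA.eigenvalues j| ^ p ≤ specPNorm ∞ (P 1) ^ (p - 1) *
      ∑ i, (P (hA.eigenProj i)).trace.re * |hA.eigenvalues i| ^ p := by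
  have hS : ∀ i j, 0 ≤ (P (hA.eigenProj i) * hPA.eigenProj j).trace.re := fun i j =>
    hPA.re_trace_mul_eigenProj_nonneg (hP _ (hA.posSemidef_eigenProj i)) j
  have h1 : ∀ j, |hPA.eigenvalues j| ^ p ≤ specPNorm ∞ (P 1) ^ (p - 1) *
      ∑ i, (P (hA.eigenProj i) * hPA.eigenProj j).trace.re * |hA.eigenvalues i| ^ p := by
    intro j
    have h2 : hPA.eigenvalues j =
        ∑ i, (P (hA.eigenProj i) * hPA.eigenProj j).trace.re * hA.eigenvalues i := by
      have h : hPA.eigenvalues j = (P A * hPA.eigenProj j).trace.re := by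
        rw [trace_self_mul_eigenProj, Complex.ofReal_re]
      have h' : P A = ∑ i, hA.eigenvalues i • P (hA.eigenProj i) := by
        conv_lhs => rw [← hA.sum_eigenvalues_smul_eigenProj]
        simp
      rw [h]
      generalize hPA.eigenProj j = V
      rw [h']
      simp [Finset.sum_mul, trace_sum, mul_comm]
    have h3 : ∑ i, (P (hA.eigenProj i) * hPA.eigenProj j).trace.re ≤ specPNorm ∞ (P 1) := by
      rw [← Complex.re_sum, ← trace_sum, ← Finset.sum_mul, ← map_sum, sum_eigenProj]
      exact (isHermitian_one.map_of_posSemidef hP).re_trace_mul_eigenProj_le hPA j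
    rw [h2]
    refine (Real.abs_sum_mul_rpow_le Finset.univ hp _ _ fun i => hS i j).trans ?_
    refine mul_le_mul_of_nonneg_right (Real.rpow_le_rpow (Finset.sum_nonneg fun i _ => hS i j) h3
      (by linarith)) (Finset.sum_nonneg fun i _ => mul_nonneg (hS i j) (by positivity))
  refine (Finset.sum_le_sum fun j _ => h1 j).trans_eq ?_
  rw [← Finset.mul_sum, Finset.sum_comm]
  congr 1
  refine Finset.sum_congr rfl fun i _ => ?_
  rw [← Finset.sum_mul, ← Complex.re_sum, ← trace_sum, ← Finset.mul_sum, sum_eigenProj, mul_one]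

/-- Hölder's inequality between the spectrum of `A` and the diagonal of `B` in an eigenbasis
of `A`. -/
lemma sum_re_trace_eigenProj_mul_rpow_le (hA : A.IsHermitian) (hB : B.IsHermitian)
    {r s q : ℝ≥0∞} (hs : 1 ≤ s) (hsr : s < r) (hq : 1 / (r / s) + 1 / q = 1) :
    ∑ i, (hA.eigenProj i * B).trace.re * |hA.eigenvalues i| ^ s.toReal ≤
      specPNorm r A ^ s.toReal * specPNorm q B := by
  have hs_top : s ≠ ∞ := hsr.ne_top
  have hs0 : s ≠ 0 := (zero_lt_one.trans_le hs).ne'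
  have hσ : 0 < s.toReal := ENNReal.toReal_pos hs0 hs_top
  by_cases hr : r = ∞
  · subst hr
    have hq1 : q = 1 := by
      rw [ENNReal.top_div_of_ne_top hs_top] at hq
      simpa using hq
    subst hq1
    have h1 := hA.sum_abs_re_trace_eigenProj_mul_rpow_le hB le_rfl
    simp only [Real.rpow_one] at h1
    rw [specPNorm_eq_sum_rpow ENNReal.one_ne_top hB]
    simp only [ENNReal.toReal_one, Real.rpow_one, div_one]
    calc _ ≤ ∑ i, specPNorm ∞ A ^ s.toReal * |(hA.eigenProj i * B).trace.re| := by
          refine Finset.sum_le_sum fun i _ => ?_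
          rw [mul_comm]
          refine (mul_le_mul_of_nonneg_left (le_abs_self _) (by positivity)).trans
            (mul_le_mul_of_nonneg_right ?_ (abs_nonneg _))
          exact Real.rpow_le_rpow (abs_nonneg _) (abs_eigenvalues_le_specPNorm_top hA i) hσ.le
      _ ≤ _ := by
          rw [← Finset.mul_sum]
          exact mul_le_mul_of_nonneg_left h1 (Real.rpow_nonneg (specPNorm_nonneg _ _) _)
  · have hσρ : s.toReal < r.toReal := (ENNReal.toReal_lt_toReal hs_top hr).2 hsr
    have hq_zero : q ≠ 0 := by
      rintro rfl
      simp at hq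
    have hq_top : q ≠ ∞ := by
      rintro rfl
      have h : r / s = 1 := by simpa using hq
      rw [ENNReal.div_eq_one_iff hs0 hs_top] at h
      exact hsr.ne' h
    have hq_real : (r.toReal / s.toReal)⁻¹ + q.toReal⁻¹ = 1 := by
      have h := congrArg ENNReal.toReal hq
      rw [ENNReal.toReal_add] at h
      · simpa using h
      · rw [one_div]
        exact ENNReal.inv_ne_top.2 (ENNReal.div_pos (hsr.bot_lt).ne' hs_top).ne'
      · simpa using hq_zero
    have hconj : (r.toReal / s.toReal).HolderConjugate q.toReal :=
      Real.holderConjugate_iff.2 ⟨(one_lt_div hσ).2 hσρ, hq_real⟩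
    have h1 := hA.sum_abs_re_trace_eigenProj_mul_rpow_le hB hconj.symm.lt.le
    have h2 := Real.inner_le_Lp_mul_Lq_of_nonneg Finset.univ hconj
      (f := fun i => |hA.eigenvalues i| ^ s.toReal) (g := fun i => |(hA.eigenProj i * B).trace.re|)
      (fun i _ => by positivity) (fun i _ => abs_nonneg _)
    have h3 : ∀ i, (|hA.eigenvalues i| ^ s.toReal) ^ (r.toReal / s.toReal) =
        |hA.eigenvalues i| ^ r.toReal := fun i => by
      rw [← Real.rpow_mul (abs_nonneg _), mul_div_cancel₀ _ hσ.ne']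
    simp only [h3] at h2
    rw [specPNorm_eq_sum_rpow hr hA, specPNorm_eq_sum_rpow hq_top hB,
      ← Real.rpow_mul (by positivity)]
    calc _ ≤ ∑ i, |hA.eigenvalues i| ^ s.toReal * |(hA.eigenProj i * B).trace.re| := by
          refine Finset.sum_le_sum fun i _ => ?_
          rw [mul_comm]
          exact mul_le_mul_of_nonneg_left (le_abs_self _) (by positivity)
      _ ≤ _ := h2
      _ ≤ _ := by
          rw [one_div_div, one_div_mul_eq_div]
          gcongr

end Matrix.IsHermitian

/-- Norm estimate for a positive linear transformation `P` on Hermitian matrices, case `s < r`: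
`‖P‖_{r→s} ≤ 2√2 ‖P(I)‖_∞^{1-1/s} ‖P*(I)‖_{(r/s)'}^{1/s}`, where `P*` is the adjoint of `P`
with respect to the trace inner product and `(r/s)'` is the conjugate exponent of `r/s`. -/
theorem positive_map_norm_s_lt_r {n : ℕ} (r s rs' : ℝ≥0∞) (hs : 1 ≤ s) (hsr : s < r)
    (hrs' : 1 / (r / s) + 1 / rs' = 1)
    (P Pstar : Matrix (Fin n) (Fin n) ℂ →ₗ[ℝ] Matrix (Fin n) (Fin n) ℂ)
    (hP : ∀ X : Matrix (Fin n) (Fin n) ℂ, X.PosSemidef → (P X).PosSemidef)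
    (hadj : ∀ X Y : Matrix (Fin n) (Fin n) ℂ, X.IsHermitian → Y.IsHermitian →
      (P X * Y).trace = (X * Pstar Y).trace) :
    hermOpNorm r s P ≤
      2 * Real.sqrt 2 * specPNorm ∞ (P 1) ^ (1 - (1 / s).toReal) *
        specPNorm rs' (Pstar 1) ^ (1 / s).toReal := by
  have hQ : (Pstar 1).IsHermitian := by
    refine Matrix.isHermitian_of_forall_trace_mul_im_eq_zero fun X hX => ?_
    rw [← hadj X 1 hX Matrix.isHermitian_one, mul_one,
      (hX.map_of_posSemidef hP).trace_eq_sum_eigenvalues]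
    simp
  have hs_top : s ≠ ∞ := hsr.ne_top
  have hσ : 1 ≤ s.toReal := by
    simpa using (ENNReal.toReal_le_toReal ENNReal.one_ne_top hs_top).2 hs
  have hσ0 : 0 < s.toReal := by linarith
  have hK := specPNorm_nonneg ∞ (P 1)
  have hD := specPNorm_nonneg rs' (Pstar 1)
  have h2 : 1 ≤ 2 * Real.sqrt 2 := by
    have := Real.one_le_sqrt.2 one_le_two
    linarith
  rw [one_div, ENNReal.toReal_inv]
  refine Real.iSup_le ?_ (by positivity)
  rintro ⟨A, hA, -⟩
  have hN := specPNorm_nonneg r A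
  refine div_le_of_le_mul₀ hN (by positivity) ?_
  have hPA := hA.map_of_posSemidef hP
  have h3 := hA.sum_abs_eigenvalues_map_rpow_le hP hPA hσ
  have h4 : ∀ i, (P (hA.eigenProj i)).trace.re = (hA.eigenProj i * Pstar 1).trace.re := fun i => by
    rw [← hadj _ 1 (hA.posSemidef_eigenProj i).isHermitian Matrix.isHermitian_one, mul_one]
  simp only [h4] at h3
  have h5 := h3.trans (mul_le_mul_of_nonneg_left
    (hA.sum_re_trace_eigenProj_mul_rpow_le hQ hs hsr hrs') (by positivity))
  have h6 : specPNorm s (P A) ≤ specPNorm ∞ (P 1) ^ (1 - s.toReal⁻¹) *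
      specPNorm rs' (Pstar 1) ^ s.toReal⁻¹ * specPNorm r A := by
    rw [specPNorm_eq_sum_rpow hs_top hPA, one_div]
    refine (Real.rpow_le_rpow (by positivity) h5 (by positivity)).trans_eq ?_
    rw [Real.mul_rpow (by positivity) (by positivity), Real.mul_rpow (by positivity) hD,
      ← Real.rpow_mul hK, ← Real.rpow_mul hN, mul_inv_cancel₀ hσ0.ne', Real.rpow_one, sub_mul,
      mul_inv_cancel₀ hσ0.ne', one_mul]
    ring
  calc _ ≤ _ := h6
    _ ≤ 2 * Real.sqrt 2 * (specPNorm ∞ (P 1) ^ (1 - s.toReal⁻¹) *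
      specPNorm rs' (Pstar 1) ^ s.toReal⁻¹ * specPNorm r A) :=
        le_mul_of_one_le_left (by positivity) h2
    _ = _ := by ring
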